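/- Let n ≥ 2p, let x_1, …, x_n ∈ ℝ^p and y_1, …, y_n ∈ ℝ be data in general position, meaning: every p of the vectors x_1, …, x_n are linearly independent, and for every subset I ⊆ {1, …, n} with |I| ≥ p + 1 the (unique) global minimizer θ*(I) of ρ_I(θ) = max_{i ∈ I} |y_i − x_iᵀθ| has exactly p + 1 active indices (indices i ∈ I with |y_i − x_iᵀθ*(I)| = ρ_I(θ*(I))). For 0 ≤ k ≤ n − (p + 1), define f_k(θ) = min over all subsets I of size n − k of ρ_I(θ), and let M_k denote the number of local minimizers of f_k. Then M_k = C(p+k, p), the binomial coefficient (p+k) choose p. -/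

import Mathlib

open scoped Classical

/-- The Chebyshev (l∞) residual function `ρ_I(θ) = max_{i ∈ I} |y i − x iᵀ θ|`
(defined as `0` for empty `I`). -/
noncomputable def rho (n p : ℕ) (x : Fin n → Fin p → ℝ) (y : Fin n → ℝ)
    (I : Finset (Fin n)) (θ : Fin p → ℝ) : ℝ :=
  if hI : I.Nonempty then I.sup' hI (fun i => |y i - ∑ j, x i j * θ j|) else 0

/-- `f_k(θ) = min_{I ⊆ {1,…,n}, |I| = n − k} ρ_I(θ)` (defined as `0` if no such `I`). -/
noncomputable def fk (n p : ℕ) (x : Fin n → Fin p → ℝ) (y : Fin n → ℝ) (k : ℕ)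
    (θ : Fin p → ℝ) : ℝ :=
  if h : (Finset.powersetCard (n - k) (Finset.univ : Finset (Fin n))).Nonempty then
    (Finset.powersetCard (n - k) (Finset.univ : Finset (Fin n))).inf' h
      (fun I => rho n p x y I θ)
  else 0

theorem aux_choose_identity (p : ℕ) : ∀ N k : ℕ, k ≤ N →
    ∑ j ∈ Finset.range (k + 1), (p + j).choose p * (N - j).choose (k - j)
      = (N + p + 1).choose k := by
  intro N
  induction N with
  | zero =>
    intro k hk
    obtain rfl : k = 0 := by omega
    simp
  | succ N ih =>
    intro k hk
    rcases Nat.lt_or_ge N k with h | h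
    · obtain rfl : k = N + 1 := by omega
      have h1 : ∑ j ∈ Finset.range (N + 1 + 1), (p + j).choose p * (N + 1 - j).choose (N + 1 - j)
          = ∑ j ∈ Finset.range (N + 1 + 1), (j + p).choose p := by
        refine Finset.sum_congr rfl fun j _ => ?_
        rw [Nat.choose_self, mul_one, add_comm]
      rw [h1, Nat.sum_range_add_choose]
      exact (Nat.choose_symm_add (a := N + 1) (b := p + 1)).symm
    · cases k with
      | zero => simp
      | succ k =>
        have e1 := ih k (by omega)
        have e2 := ih (k + 1) h
        have : N + 1 + p + 1 = (N + p + 1) + 1 := by omega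
        rw [this, Nat.choose_succ_succ, ← e1, ← e2]
        rw [Finset.sum_range_succ _ (k + 1), Finset.sum_range_succ _ (k + 1)]
        rw [← add_assoc (Finset.sum _ _), ← Finset.sum_add_distrib]
        congr 1
        · refine Finset.sum_congr rfl fun j hj => ?_
          have hj' : j ≤ k := by simpa [Nat.lt_succ_iff] using hj
          have a1 : N + 1 - j = (N - j) + 1 := by omega
          have a2 : k + 1 - j = (k - j) + 1 := by omega
          rw [a1, a2, Nat.choose_succ_succ, mul_add]
        · simp

theorem aux_interval_card {α : Type*} [DecidableEq α] [Fintype α] (A J : Finset α) (hAJ : A ⊆ J) (m : ℕ)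
    (hm : A.card ≤ m) :
    ((Finset.powersetCard m (Finset.univ : Finset α)).filter (fun I => A ⊆ I ∧ I ⊆ J)).card
      = (J.card - A.card).choose (m - A.card) := by
  rw [← Finset.card_sdiff_of_subset hAJ, ← Finset.card_powersetCard]
  symm
  refine Finset.card_bij (fun S _ => A ∪ S) ?_ ?_ ?_
  · intro S hS
    rw [Finset.mem_powersetCard] at hS
    have hd : Disjoint A S := by
      rw [Finset.disjoint_left]
      intro a ha hs
      exact (Finset.mem_sdiff.1 (hS.1 hs)).2 ha
    simp only [Finset.mem_filter, Finset.mem_powersetCard, Finset.subset_univ, true_and]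
    refine ⟨?_, Finset.subset_union_left, Finset.union_subset hAJ (hS.1.trans Finset.sdiff_subset)⟩
    rw [Finset.card_union_of_disjoint hd, hS.2]; omega
  · intro S hS T hT h
    rw [Finset.mem_powersetCard] at hS hT
    ext i
    have := Finset.ext_iff.1 h i
    have h1 := @hS.1 i
    have h2 := @hT.1 i
    simp only [Finset.mem_union, Finset.mem_sdiff] at *
    tauto
  · intro I hI
    simp only [Finset.mem_filter, Finset.mem_powersetCard, Finset.subset_univ, true_and] at hI
    refine ⟨I \ A, ?_, ?_⟩
    · rw [Finset.mem_powersetCard]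
      refine ⟨Finset.sdiff_subset_sdiff hI.2.2 le_rfl, ?_⟩
      rw [Finset.card_sdiff_of_subset hI.2.1, hI.1]
    · exact Finset.union_sdiff_of_subset hI.2.1

theorem aux_closed_count (n p : ℕ) (hpn : p + 1 ≤ n)
    (A cl : Finset (Fin n) → Finset (Fin n))
    (hA : ∀ I, p + 1 ≤ I.card → A I ⊆ I ∧ I ⊆ cl I ∧ (A I).card = p + 1)
    (hloc : ∀ I J, p + 1 ≤ I.card → A I ⊆ J → J ⊆ cl I → A J = A I ∧ cl J = cl I) :
    ∀ k, k ≤ n - (p + 1) →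
      ((Finset.powersetCard (n - k) (Finset.univ : Finset (Fin n))).filter
        (fun J => cl J = J)).card = (p + k).choose p := by
  intro k
  induction k using Nat.strong_induction_on with
  | _ k ih =>
  intro hk
  have hid := aux_choose_identity p (n - (p + 1)) k hk
  have hN : n - (p + 1) + p + 1 = n := by omega
  rw [hN, Finset.sum_range_succ] at hid
  have hfib : ∀ j, j ≤ k → ∀ J ∈ (Finset.powersetCard (n - j) (Finset.univ : Finset (Fin n))).filter
        (fun J => cl J = J),
      ((Finset.powersetCard (n - k) (Finset.univ : Finset (Fin n))).filter
        (fun I => cl I = J)).card = (n - (p + 1) - j).choose (k - j) := by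
    intro j hj J hJ
    simp only [Finset.mem_filter, Finset.mem_powersetCard, Finset.subset_univ, true_and] at hJ
    obtain ⟨hJc, hJcl⟩ := hJ
    obtain ⟨a1, a2, a3⟩ := hA J (by omega)
    have := aux_interval_card (A J) J a1 (n - k) (by omega)
    have e : n - (p + 1) - j = J.card - (A J).card := by omega
    have e2 : (n - (p + 1) - j).choose (k - j) = (J.card - (A J).card).choose (n - k - (A J).card) := by
      rw [← e]
      apply Nat.choose_symm_of_eq_add
      omega
    rw [e2, ← this]
    congr 1
    apply Finset.filter_congr
    intro I hI
    simp only [Finset.mem_powersetCard, Finset.subset_univ, true_and] at hI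
    obtain ⟨b1, b2, b3⟩ := hA I (by omega)
    constructor
    · intro h
      have := (hloc I J (by omega) (b1.trans (h ▸ b2)) h.ge).1
      exact ⟨this ▸ b1, h ▸ b2⟩
    · rintro ⟨h1, h2⟩
      rw [(hloc J I (by omega) h1 (by rw [hJcl]; exact h2)).2, hJcl]
  have htot : (Finset.powersetCard (n - k) (Finset.univ : Finset (Fin n))).card
      = ∑ j ∈ Finset.range (k + 1),
        ((Finset.powersetCard (n - j) (Finset.univ : Finset (Fin n))).filter
          (fun J => cl J = J)).card * (n - (p + 1) - j).choose (k - j) := by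
    have hmap : ∀ I ∈ Finset.powersetCard (n - k) (Finset.univ : Finset (Fin n)),
        n - (cl I).card ∈ Finset.range (k + 1) := by
      intro I hI
      simp only [Finset.mem_powersetCard, Finset.subset_univ, true_and] at hI
      have := Finset.card_le_card (hA I (by omega)).2.1
      simp only [Finset.mem_range]
      omega
    rw [Finset.card_eq_sum_card_fiberwise hmap]
    refine Finset.sum_congr rfl fun j hj => ?_
    have hj' : j ≤ k := by simpa [Nat.lt_succ_iff] using hj
    have hmap2 : ∀ I ∈ (Finset.powersetCard (n - k) (Finset.univ : Finset (Fin n))).filter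
        (fun I => n - (cl I).card = j), cl I ∈
        (Finset.powersetCard (n - j) (Finset.univ : Finset (Fin n))).filter
          (fun J => cl J = J) := by
      intro I hI
      simp only [Finset.mem_filter, Finset.mem_powersetCard, Finset.subset_univ, true_and] at hI ⊢
      obtain ⟨b1, b2, b3⟩ := hA I (by omega)
      have := Finset.card_le_univ (cl I)
      rw [Fintype.card_fin] at this
      exact ⟨by omega, (hloc I (cl I) (by omega) (b1.trans b2) le_rfl).2⟩
    rw [Finset.card_eq_sum_card_fiberwise hmap2, ← smul_eq_mul, ← Finset.sum_const]
    refine Finset.sum_congr rfl fun J hJ => ?_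
    rw [← hfib j hj' J hJ, Finset.filter_filter]
    congr 1
    apply Finset.filter_congr
    intro I hI
    simp only [Finset.mem_filter, Finset.mem_powersetCard, Finset.subset_univ, true_and] at hJ
    constructor
    · exact fun h => h.2
    · intro h
      refine ⟨?_, h⟩
      rw [h, hJ.1]; omega
  rw [Finset.card_powersetCard, Finset.card_univ, Fintype.card_fin, Nat.choose_symm (by omega),
    Finset.sum_range_succ, ← hid] at htot
  have : ∑ j ∈ Finset.range k, (p + j).choose p * (n - (p + 1) - j).choose (k - j)
      = ∑ j ∈ Finset.range k,
        ((Finset.powersetCard (n - j) (Finset.univ : Finset (Fin n))).filter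
          (fun J => cl J = J)).card * (n - (p + 1) - j).choose (k - j) := by
    refine Finset.sum_congr rfl fun j hj => ?_
    have hj' := Finset.mem_range.1 hj
    rw [ih j hj' (by omega)]
  rw [this] at htot
  simp only [Nat.sub_self, Nat.choose_zero_right, mul_one] at htot
  omega

section analytic
variable {n p : ℕ} {x : Fin n → Fin p → ℝ} {y : Fin n → ℝ}

theorem aux_le_rho {I : Finset (Fin n)} {i : Fin n} (hi : i ∈ I) (θ : Fin p → ℝ) :
    |y i - ∑ j, x i j * θ j| ≤ rho n p x y I θ := by
  have hI : I.Nonempty := ⟨i, hi⟩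
  rw [rho, dif_pos hI]
  exact Finset.le_sup' (fun i => |y i - ∑ j, x i j * θ j|) hi

theorem aux_rho_le {I : Finset (Fin n)} (hI : I.Nonempty) {θ : Fin p → ℝ} {c : ℝ}
    (h : ∀ i ∈ I, |y i - ∑ j, x i j * θ j| ≤ c) : rho n p x y I θ ≤ c := by
  rw [rho, dif_pos hI]
  exact Finset.sup'_le hI _ h

theorem aux_rho_attained {I : Finset (Fin n)} (hI : I.Nonempty) (θ : Fin p → ℝ) :
    ∃ i ∈ I, |y i - ∑ j, x i j * θ j| = rho n p x y I θ := by
  rw [rho, dif_pos hI]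
  obtain ⟨i, hi, h⟩ := Finset.exists_mem_eq_sup' hI (fun i => |y i - ∑ j, x i j * θ j|)
  exact ⟨i, hi, h.symm⟩

theorem aux_fk_le {k : ℕ} {I : Finset (Fin n)} (hI : I.card = n - k) (θ : Fin p → ℝ) :
    fk n p x y k θ ≤ rho n p x y I θ := by
  have hm : I ∈ Finset.powersetCard (n - k) (Finset.univ : Finset (Fin n)) := by simp [hI]
  rw [fk, dif_pos ⟨I, hm⟩]
  exact Finset.inf'_le (fun I => rho n p x y I θ) hm

theorem aux_fk_attained (k : ℕ) (θ : Fin p → ℝ) :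
    ∃ I : Finset (Fin n), I.card = n - k ∧ fk n p x y k θ = rho n p x y I θ := by
  have hne : (Finset.powersetCard (n - k) (Finset.univ : Finset (Fin n))).Nonempty := by
    rw [Finset.powersetCard_nonempty]; simp
  rw [fk, dif_pos hne]
  obtain ⟨I, hI, h⟩ := Finset.exists_mem_eq_inf' hne (fun I => rho n p x y I θ)
  exact ⟨I, by simpa using hI, h⟩

theorem aux_res_lin (i : Fin n) (u v : Fin p → ℝ) (a b : ℝ) (hab : a + b = 1) :
    y i - ∑ j, x i j * (a • u + b • v) j
      = a * (y i - ∑ j, x i j * u j) + b * (y i - ∑ j, x i j * v j) := by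
  have : ∑ j, x i j * (a • u + b • v) j = a * ∑ j, x i j * u j + b * ∑ j, x i j * v j := by
    rw [Finset.mul_sum, Finset.mul_sum, ← Finset.sum_add_distrib]
    refine Finset.sum_congr rfl fun j _ => ?_
    simp only [Pi.add_apply, Pi.smul_apply, smul_eq_mul]; ring
  rw [this]
  linear_combination (-(y i)) * hab

theorem aux_res_convex (i : Fin n) (u v : Fin p → ℝ) (a b : ℝ) (ha : 0 ≤ a) (hb : 0 ≤ b)
    (hab : a + b = 1) :
    |y i - ∑ j, x i j * (a • u + b • v) j|
      ≤ a * |y i - ∑ j, x i j * u j| + b * |y i - ∑ j, x i j * v j| := by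
  rw [aux_res_lin i u v a b hab]
  refine (abs_add_le _ _).trans ?_
  rw [abs_mul, abs_mul, abs_of_nonneg ha, abs_of_nonneg hb]

theorem aux_rho_convex {I : Finset (Fin n)} (hI : I.Nonempty) :
    ConvexOn ℝ Set.univ (rho n p x y I) := by
  refine ⟨convex_univ, fun u _ v _ a b ha hb hab => ?_⟩
  refine aux_rho_le hI fun i hi => ?_
  refine (aux_res_convex i u v a b ha hb hab).trans ?_
  simp only [smul_eq_mul]
  have := aux_le_rho (x := x) (y := y) hi u
  have := aux_le_rho (x := x) (y := y) hi v
  gcongr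

theorem aux_res_cont (i : Fin n) : Continuous fun θ : Fin p → ℝ => |y i - ∑ j, x i j * θ j| := by
  fun_prop

theorem aux_exists_min {I : Finset (Fin n)} (hI : I.Nonempty) :
    ∃ θ : Fin p → ℝ, ∀ θ', rho n p x y I θ ≤ rho n p x y I θ' := by
  let L : (Fin p → ℝ) →ₗ[ℝ] (I → ℝ) :=
    Matrix.mulVecLin (Matrix.of fun (i : I) (j : Fin p) => x i j)
  have hL : ∀ θ (i : I), L θ i = ∑ j, x i j * θ j := by
    intro θ i
    simp [L, Matrix.mulVec, dotProduct]
  let yy : I → ℝ := fun i => y i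
  have hd : ∀ θ, rho n p x y I θ = dist yy (L θ) := by
    intro θ
    apply le_antisymm
    · refine aux_rho_le hI fun i hi => ?_
      have := dist_le_pi_dist yy (L θ) ⟨i, hi⟩
      rwa [Real.dist_eq, hL] at this
    · obtain ⟨i0, hi0, _⟩ := aux_rho_attained (x := x) (y := y) hI θ
      have h0 : 0 ≤ rho n p x y I θ := (abs_nonneg _).trans (aux_le_rho hi0 θ)
      rw [dist_pi_le_iff h0]
      intro i
      rw [Real.dist_eq, hL]
      exact aux_le_rho i.2 θ
  have hc : IsClosed ((LinearMap.range L : Submodule ℝ (I → ℝ)) : Set (I → ℝ)) :=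
    Submodule.closed_of_finiteDimensional _
  obtain ⟨z, hz, hz2⟩ := hc.exists_infDist_eq_dist ⟨0, Submodule.zero_mem _⟩ yy
  obtain ⟨θ, rfl⟩ := hz
  refine ⟨θ, fun θ' => ?_⟩
  rw [hd, hd, ← hz2]
  exact Metric.infDist_le_dist_of_mem ⟨θ', rfl⟩

theorem aux_local {I J : Finset (Fin n)} (hI : I.Nonempty) {θ : Fin p → ℝ}
    (hmin : ∀ θ', rho n p x y I θ ≤ rho n p x y I θ')
    (h1 : I.filter (fun i => |y i - ∑ j, x i j * θ j| = rho n p x y I θ) ⊆ J)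
    (h2 : ∀ i ∈ J, |y i - ∑ j, x i j * θ j| ≤ rho n p x y I θ) :
    rho n p x y J θ = rho n p x y I θ ∧ ∀ θ', rho n p x y J θ ≤ rho n p x y J θ' := by
  obtain ⟨i0, hi0, hi0'⟩ := aux_rho_attained (x := x) (y := y) hI θ
  have hi0J : i0 ∈ J := h1 (Finset.mem_filter.2 ⟨hi0, hi0'⟩)
  have hJ : J.Nonempty := ⟨i0, hi0J⟩
  have he : rho n p x y J θ = rho n p x y I θ :=
    le_antisymm (aux_rho_le hJ h2) (hi0' ▸ aux_le_rho hi0J θ)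
  refine ⟨he, fun θ' => ?_⟩
  by_contra! hlt
  rw [he] at hlt
  have hev : ∀ᶠ t : ℝ in nhdsWithin 0 (Set.Ioi 0), t < 1 ∧ 0 < t ∧ ∀ i ∈ I,
      |y i - ∑ j, x i j * ((1 - t) • θ + t • θ') j| < rho n p x y I θ := by
    refine Filter.Eventually.and ?_ (Filter.Eventually.and ?_ ?_)
    · exact nhdsWithin_le_nhds (eventually_lt_nhds (by norm_num))
    · exact eventually_mem_nhdsWithin
    · rw [Filter.eventually_all_finset]
      intro i hi
      by_cases hia : |y i - ∑ j, x i j * θ j| = rho n p x y I θ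
      · have hiJ : i ∈ J := h1 (Finset.mem_filter.2 ⟨hi, hia⟩)
        have hb : ∀ᶠ t : ℝ in nhdsWithin 0 (Set.Ioi 0), t < 1 :=
          nhdsWithin_le_nhds (eventually_lt_nhds (by norm_num))
        filter_upwards [hb, eventually_mem_nhdsWithin] with t ht1 ht0
        have ht0' : 0 < t := ht0
        have := aux_res_convex (x := x) (y := y) i θ θ' (1 - t) t (by linarith) ht0'.le (by ring)
        have h3 := aux_le_rho (x := x) (y := y) hiJ θ'
        rw [hia] at this
        nlinarith
      · have hlt' := lt_of_le_of_ne (aux_le_rho (x := x) (y := y) hi θ) hia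
        have hc : Continuous fun t : ℝ => |y i - ∑ j, x i j * ((1 - t) • θ + t • θ') j| := by
          simp only [Pi.add_apply, Pi.smul_apply, smul_eq_mul]
          fun_prop
        have : Filter.Tendsto (fun t : ℝ => |y i - ∑ j, x i j * ((1 - t) • θ + t • θ') j|)
            (nhds 0) (nhds |y i - ∑ j, x i j * θ j|) := by
          have := hc.tendsto 0
          simpa using this
        exact nhdsWithin_le_nhds (this.eventually_lt_const hlt')
  obtain ⟨t, _, _, ht⟩ := hev.exists
  obtain ⟨i, hi, hie⟩ := aux_rho_attained (x := x) (y := y) hI ((1 - t) • θ + t • θ')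
  have := hmin ((1 - t) • θ + t • θ')
  have := ht i hi
  linarith

theorem aux_unique
    (haar : ∀ s : Finset (Fin n), s.card = p →
      LinearIndependent ℝ (fun i : s => x i))
    {I : Finset (Fin n)} (hIc : p + 1 ≤ I.card)
    (hact : ∀ θs : Fin p → ℝ, (∀ θ : Fin p → ℝ, rho n p x y I θs ≤ rho n p x y I θ) →
        (I.filter (fun i => |y i - ∑ j, x i j * θs j| = rho n p x y I θs)).card = p + 1)
    {u v : Fin p → ℝ} (hu : ∀ θ, rho n p x y I u ≤ rho n p x y I θ)
    (hv : ∀ θ, rho n p x y I v ≤ rho n p x y I θ) : u = v := by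
  have hI : I.Nonempty := Finset.card_pos.1 (by omega)
  have huv : rho n p x y I u = rho n p x y I v := le_antisymm (hu v) (hv u)
  set m : Fin p → ℝ := (1 / 2 : ℝ) • u + (1 / 2 : ℝ) • v with hm
  have hmle : rho n p x y I m ≤ rho n p x y I u := by
    have := (aux_rho_convex (x := x) (y := y) hI).2 (Set.mem_univ u) (Set.mem_univ v)
      (show (0 : ℝ) ≤ 1 / 2 by norm_num) (show (0 : ℝ) ≤ 1 / 2 by norm_num) (by norm_num)
    simp only [smul_eq_mul] at this
    rw [hm]
    linarith
  have hmeq : rho n p x y I m = rho n p x y I u := le_antisymm hmle (hu m)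
  have hcard := hact m (fun θ => hmle.trans (hu θ))
  have hzero : ∀ i ∈ I.filter (fun i => |y i - ∑ j, x i j * m j| = rho n p x y I m),
      ∑ j, x i j * (u j - v j) = 0 := by
    intro i hi
    obtain ⟨hi, hie⟩ := Finset.mem_filter.1 hi
    have e := aux_res_lin (x := x) (y := y) i u v (1 / 2) (1 / 2) (by norm_num)
    rw [← hm] at e
    rw [hmeq] at hie
    have h1 := aux_le_rho (x := x) (y := y) hi u
    have h2 := aux_le_rho (x := x) (y := y) hi v
    rw [← huv] at h2
    rw [abs_le] at h1 h2
    have e2 : ∑ j, x i j * (u j - v j) = ∑ j, x i j * u j - ∑ j, x i j * v j := by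
      simp only [mul_sub, Finset.sum_sub_distrib]
    rw [e2]
    rcases abs_choice (y i - ∑ j, x i j * m j) with h | h <;> rw [h] at hie <;> linarith
  obtain ⟨s, hs, hsc⟩ := Finset.exists_subset_card_eq ((Nat.le_succ p).trans hcard.ge)
  have hli := haar s hsc
  have hspan : Submodule.span ℝ (Set.range (fun i : s => x i)) = ⊤ :=
    hli.span_eq_top_of_card_eq_finrank' (by simp [hsc])
  let φ : (Fin p → ℝ) →ₗ[ℝ] ℝ :=
    { toFun := fun w => ∑ j, w j * (u j - v j)
      map_add' := by intro a b; simp [add_mul, Finset.sum_add_distrib]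
      map_smul' := by intro a b; simp [Finset.mul_sum, mul_assoc] }
  have hφ : φ = 0 := by
    refine LinearMap.ext_on_range hspan ?_
    intro i
    exact hzero i (hs i.2)
  have h0 : φ (u - v) = 0 := by rw [hφ]; rfl
  have h0' : ∑ j, (u j - v j) * (u j - v j) = 0 := h0
  rw [Finset.sum_eq_zero_iff_of_nonneg (fun j _ => mul_self_nonneg _)] at h0'
  funext j
  have := mul_self_eq_zero.1 (h0' j (Finset.mem_univ j))
  linarith

end analytic

theorem card_localMin_fk_eq_choose (n p k : ℕ) (hn : 2 * p ≤ n) (hpn : p + 1 ≤ n)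
    (hk : k ≤ n - (p + 1)) (x : Fin n → Fin p → ℝ) (y : Fin n → ℝ)
    (haar : ∀ s : Finset (Fin n), s.card = p →
      LinearIndependent ℝ (fun i : s => x i))
    (hactive : ∀ I : Finset (Fin n), p + 1 ≤ I.card →
      ∀ θs : Fin p → ℝ, (∀ θ : Fin p → ℝ, rho n p x y I θs ≤ rho n p x y I θ) →
        (I.filter (fun i => |y i - ∑ j, x i j * θs j| = rho n p x y I θs)).card = p + 1) :
    {θs : Fin p → ℝ | IsLocalMin (fk n p x y k) θs}.ncard = Nat.choose (p + k) p := by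
  have hex : ∀ I : Finset (Fin n), ∃ θ : Fin p → ℝ, p + 1 ≤ I.card →
      ∀ θ', rho n p x y I θ ≤ rho n p x y I θ' := by
    intro I
    by_cases h : p + 1 ≤ I.card
    · obtain ⟨θ, hθ⟩ := aux_exists_min (x := x) (y := y) (I := I) (Finset.card_pos.1 (by omega))
      exact ⟨θ, fun _ => hθ⟩
    · exact ⟨0, fun h' => absurd h' h⟩
  choose T hT using hex
  have huniq : ∀ I : Finset (Fin n), p + 1 ≤ I.card → ∀ θ,
      (∀ θ', rho n p x y I θ ≤ rho n p x y I θ') → θ = T I := fun I hI θ hθ =>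
    aux_unique haar hI (hactive I hI) hθ (hT I hI)
  set A : Finset (Fin n) → Finset (Fin n) := fun I =>
    I.filter (fun i => |y i - ∑ j, x i j * T I j| = rho n p x y I (T I)) with hAdef
  set cl : Finset (Fin n) → Finset (Fin n) := fun I =>
    Finset.univ.filter (fun i => |y i - ∑ j, x i j * T I j| ≤ rho n p x y I (T I)) with hcldef
  have hA : ∀ I, p + 1 ≤ I.card → A I ⊆ I ∧ I ⊆ cl I ∧ (A I).card = p + 1 := by
    intro I hI
    refine ⟨Finset.filter_subset _ _, fun i hi => ?_, hactive I hI _ (hT I hI)⟩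
    exact Finset.mem_filter.2 ⟨Finset.mem_univ _, aux_le_rho hi _⟩
  have hstep : ∀ I J, p + 1 ≤ I.card → A I ⊆ J → J ⊆ cl I →
      p + 1 ≤ J.card ∧ T J = T I ∧ rho n p x y J (T J) = rho n p x y I (T I) := by
    intro I J hI h1 h2
    have hJ : p + 1 ≤ J.card := (hA I hI).2.2 ▸ Finset.card_le_card h1
    obtain ⟨e1, e2⟩ := aux_local (J := J) (Finset.card_pos.1 (by omega)) (hT I hI) h1
      (fun i hi => (Finset.mem_filter.1 (h2 hi)).2)
    have e3 := huniq J hJ _ e2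
    exact ⟨hJ, e3.symm, by rw [← e3, e1]⟩
  have hAcl : ∀ I, p + 1 ≤ I.card → A I = A (cl I) := by
    intro I hI
    obtain ⟨a1, a2, a3⟩ := hA I hI
    obtain ⟨b1, b2, b3⟩ := hstep I (cl I) hI (a1.trans a2) le_rfl
    apply Finset.eq_of_subset_of_card_le
    · intro i hi
      refine Finset.mem_filter.2 ⟨a2 (a1 hi), ?_⟩
      rw [b3, b2]
      exact (Finset.mem_filter.1 hi).2
    · rw [a3, (hA _ b1).2.2]
  have hloc : ∀ I J, p + 1 ≤ I.card → A I ⊆ J → J ⊆ cl I → A J = A I ∧ cl J = cl I := by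
    intro I J hI h1 h2
    obtain ⟨b1, b2, b3⟩ := hstep I J hI h1 h2
    have hc : cl J = cl I := by
      simp only [hcldef]
      rw [b3, b2]
    exact ⟨by rw [hAcl I hI, hAcl J b1, hc], hc⟩
  have hcount := aux_closed_count n p hpn A cl hA hloc k hk
  rw [← hcount]
  have hglob : ∀ θ, IsLocalMin (fk n p x y k) θ → ∀ I : Finset (Fin n), I.card = n - k →
      fk n p x y k θ = rho n p x y I θ → ∀ θ', rho n p x y I θ ≤ rho n p x y I θ' := by
    intro θ hθ I hI he θ'
    have hne : I.Nonempty := Finset.card_pos.1 (by omega)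
    have hl : IsLocalMin (rho n p x y I) θ := by
      filter_upwards [hθ] with z hz
      rw [← he]
      exact hz.trans (aux_fk_le hI z)
    exact IsMinOn.of_isLocalMin_of_convex_univ hl (aux_rho_convex hne) θ'
  have hset : {θs : Fin p → ℝ | IsLocalMin (fk n p x y k) θs}
      = T '' (((Finset.powersetCard (n - k) (Finset.univ : Finset (Fin n))).filter
        (fun J => cl J = J) : Finset (Finset (Fin n))) : Set (Finset (Fin n))) := by
    ext θ
    simp only [Set.mem_setOf_eq, Set.mem_image, Finset.coe_filter, Finset.mem_powersetCard,
      Finset.subset_univ, true_and]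
    constructor
    · intro hθ
      obtain ⟨I, hI, he⟩ := aux_fk_attained (x := x) (y := y) k θ
      have hIc : p + 1 ≤ I.card := by omega
      have hmin := hglob θ hθ I hI he
      have hθT := huniq I hIc θ hmin
      refine ⟨I, ⟨hI, ?_⟩, hθT.symm⟩
      obtain ⟨a1, a2, a3⟩ := hA I hIc
      refine Finset.Subset.antisymm ?_ a2
      intro i hi
      by_contra hiI
      obtain ⟨a, ha⟩ := Finset.card_pos.1 (show 0 < (A I).card by omega)
      have haI := a1 ha
      have hri := (Finset.mem_filter.1 hi).2
      set I' := insert i (I.erase a) with hI'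
      have hI'c : I'.card = n - k := by
        rw [hI', Finset.card_insert_of_notMem (fun h => hiI (Finset.mem_of_mem_erase h)),
          Finset.card_erase_of_mem haI]
        omega
      have hI'cl : I' ⊆ cl I := by
        intro j hj
        rcases Finset.mem_insert.1 hj with rfl | hj
        · exact hi
        · exact a2 (Finset.mem_of_mem_erase hj)
      have hle : rho n p x y I' θ ≤ rho n p x y I θ := by
        refine aux_rho_le ⟨i, Finset.mem_insert_self _ _⟩ fun j hj => ?_
        rw [hθT]
        exact (Finset.mem_filter.1 (hI'cl hj)).2
      have he' : fk n p x y k θ = rho n p x y I' θ :=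
        le_antisymm (aux_fk_le hI'c θ) (he ▸ hle)
      have hcard := hactive I' (by omega) θ (hglob θ hθ I' hI'c he')
      have hsub : I'.filter (fun i => |y i - ∑ j, x i j * θ j| = rho n p x y I' θ)
          ⊆ (A I).erase a := by
        intro j hj
        obtain ⟨hj1, hj2⟩ := Finset.mem_filter.1 hj
        rw [← he', he, hθT] at hj2
        have hjA : j ∈ A I := by
          rw [hAcl I hIc]
          obtain ⟨b1, b2, b3⟩ := hstep I (cl I) hIc (a1.trans a2) le_rfl
          refine Finset.mem_filter.2 ⟨hI'cl hj1, ?_⟩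
          rw [b3, b2]
          exact hj2
        refine Finset.mem_erase.2 ⟨?_, hjA⟩
        rintro rfl
        rcases Finset.mem_insert.1 hj1 with h | h
        · exact hiI (h ▸ haI)
        · exact (Finset.mem_erase.1 h).1 rfl
      have := Finset.card_le_card hsub
      rw [hcard, Finset.card_erase_of_mem ha] at this
      omega
    · rintro ⟨J, ⟨hJ, hJcl⟩, rfl⟩
      have hJc : p + 1 ≤ J.card := by omega
      have hev : ∀ᶠ θ' in nhds (T J), ∀ i ∈ Jᶜ,
          rho n p x y J (T J) < |y i - ∑ j, x i j * θ' j| := by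
        rw [Filter.eventually_all_finset]
        intro i hi
        have : rho n p x y J (T J) < |y i - ∑ j, x i j * T J j| := by
          by_contra! h
          exact Finset.mem_compl.1 hi (hJcl ▸ Finset.mem_filter.2 ⟨Finset.mem_univ _, h⟩)
        exact ((aux_res_cont i).tendsto (T J)).eventually_const_lt this
      filter_upwards [hev] with θ' hθ'
      refine (aux_fk_le hJ _).trans ?_
      obtain ⟨I, hI, he⟩ := aux_fk_attained (x := x) (y := y) k θ'
      rw [he]
      by_cases hIJ : I ⊆ J
      · have : I = J := Finset.eq_of_subset_of_card_le hIJ (by omega)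
        rw [this]
        exact hT J hJc θ'
      · obtain ⟨i, hi, hiJ⟩ := Finset.not_subset.1 hIJ
        exact (hθ' i (Finset.mem_compl.2 hiJ)).le.trans (aux_le_rho hi θ')
  rw [hset, Set.ncard_image_of_injOn, Set.ncard_coe_finset]
  have key : ∀ J J' : Finset (Fin n), J.card = n - k → cl J = J → J'.card = n - k → cl J' = J' →
      T J = T J' → rho n p x y J (T J) ≤ rho n p x y J' (T J') → J = J' := by
    intro J J' h1 h2 h3 h4 h5 h6
    refine Finset.eq_of_subset_of_card_le ?_ (by omega)
    intro i hi
    rw [← h2] at hi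
    rw [← h4]
    refine Finset.mem_filter.2 ⟨Finset.mem_univ _, ?_⟩
    rw [← h5]
    rw [← h5] at h6
    exact (Finset.mem_filter.1 hi).2.trans h6
  intro J hJ J' hJ' h
  simp only [Finset.coe_filter, Finset.mem_powersetCard, Finset.subset_univ, true_and,
    Set.mem_setOf_eq] at hJ hJ'
  rcases le_total (rho n p x y J (T J)) (rho n p x y J' (T J')) with h' | h'
  · exact key J J' hJ.1 hJ.2 hJ'.1 hJ'.2 h h'
  · exact (key J' J hJ'.1 hJ'.2 hJ.1 hJ.2 h.symm h').symm
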